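/- Let n, k, m be integers with n ≥ 1, k ≥ 0 and m ≥ ⌊n/2⌋ + 1. Let β₀,…,β_{k+m} be nonnegative real numbers with ρ := Σ_{i=0}^{k+m} (i+1)β_i ≤ 2m+2k+4 and ρ > 0, and for each 0 ≤ i ≤ k+m set a_i := ( (i+1)/(2m+2k+4) − i/n − 1/(n+1) ) / ( 1/2 − (k+m+1)/n − 1/(n+1) ). Then the denominator 1/2 − (k+m+1)/n − 1/(n+1) is negative, each a_i ∈ [ i/(k+m+1), 1 ], and Σ_{i=0}^{k+m} a_i β_i ≤ (ρ/(2m+2k+4))·( 2 − 4/( (k+m+1)(2(k+m+1)(n+1) − n(n−1)) ) ) < 2. -/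

import Mathlib

/-!
STATEMENT 19: the key exponent computation in the interpolation argument.
-/

/-- Closed form of the interpolation exponent, with the denominator cleared. -/
theorem interpolation_exponent_closed_form {N s x K : ℝ} (hN : 0 < N) (hs : 0 < s)
    (hK : K = 2 * s * (N + 1) - N * (N - 1)) (hKpos : 0 < K) :
    ((x + 1) / (2 * (s + 1)) - x / N - 1 / (N + 1)) / (1 / 2 - s / N - 1 / (N + 1)) =
      (K - 2 * s + x * (K + 2)) / ((s + 1) * K) := by
  have hD : 1 / 2 - s / N - 1 / (N + 1) = -(K / (2 * N * (N + 1))) := by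
    rw [hK]; field_simp; ring
  have hDne : -(K / (2 * N * (N + 1))) ≠ 0 := neg_ne_zero.mpr (by positivity)
  rw [hD, div_eq_iff hDne]
  field_simp
  rw [hK]
  ring

theorem interpolation_exponent_computation
    (n k m : ℕ) (hn : 1 ≤ n) (hm : n / 2 + 1 ≤ m)
    (β : ℕ → ℝ) (hβ : ∀ i, i ≤ k + m → 0 ≤ β i)
    (ρ : ℝ)
    (hρdef : ρ = ∑ i ∈ Finset.range (k + m + 1), ((i : ℝ) + 1) * β i)
    (hρle : ρ ≤ 2 * (m : ℝ) + 2 * (k : ℝ) + 4) (hρpos : 0 < ρ)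
    (a : ℕ → ℝ)
    (hadef : ∀ i, i ≤ k + m →
      a i = (((i : ℝ) + 1) / (2 * (m : ℝ) + 2 * (k : ℝ) + 4)
              - (i : ℝ) / (n : ℝ) - 1 / ((n : ℝ) + 1)) /
            ((1 : ℝ) / 2 - ((k : ℝ) + (m : ℝ) + 1) / (n : ℝ) - 1 / ((n : ℝ) + 1))) :
    ((1 : ℝ) / 2 - ((k : ℝ) + (m : ℝ) + 1) / (n : ℝ) - 1 / ((n : ℝ) + 1) < 0)
    ∧ (∀ i, i ≤ k + m → (i : ℝ) / ((k : ℝ) + (m : ℝ) + 1) ≤ a i ∧ a i ≤ 1)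
    ∧ (∑ i ∈ Finset.range (k + m + 1), a i * β i
        ≤ (ρ / (2 * (m : ℝ) + 2 * (k : ℝ) + 4)) *
            (2 - 4 / (((k : ℝ) + (m : ℝ) + 1) *
              (2 * ((k : ℝ) + (m : ℝ) + 1) * ((n : ℝ) + 1) - (n : ℝ) * ((n : ℝ) - 1)))))
    ∧ (∑ i ∈ Finset.range (k + m + 1), a i * β i < 2) := by
  have hN : (1 : ℝ) ≤ n := by exact_mod_cast hn
  obtain ⟨s, hs⟩ : ∃ s : ℝ, s = (k : ℝ) + (m : ℝ) + 1 := ⟨_, rfl⟩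
  have hsn : (n : ℝ) + 3 ≤ 2 * s := by
    have h : n + 3 ≤ 2 * (k + m + 1) := by omega
    rw [hs]; exact_mod_cast h
  have hp : 2 * (m : ℝ) + 2 * (k : ℝ) + 4 = 2 * (s + 1) := by rw [hs]; ring
  rw [hp] at hρle
  simp only [hp, ← hs] at hadef ⊢
  obtain ⟨K, hK⟩ : ∃ K : ℝ, K = 2 * s * ((n : ℝ) + 1) - n * ((n : ℝ) - 1) := ⟨_, rfl⟩
  rw [← hK]
  have hN0 : (0 : ℝ) < n := by linarith
  have hs0 : 0 < s := by linarith
  have hK2s : 2 * s < K := by rw [hK]; nlinarith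
  have hK0 : 0 < K := by linarith
  have ha : ∀ i, i ≤ k + m → a i = (K - 2 * s + i * (K + 2)) / ((s + 1) * K) := fun i hi => by
    rw [hadef i hi, interpolation_exponent_closed_form hN0 hs0 hK hK0]
  have his : ∀ i, i ≤ k + m → (i : ℝ) ≤ s - 1 := fun i hi => by
    have h : (i : ℝ) ≤ k + m := by exact_mod_cast hi
    linarith
  have hsum : ∑ i ∈ Finset.range (k + m + 1), a i * β i ≤
      ρ / (2 * (s + 1)) * (2 - 4 / (s * K)) := by
    have hrhs : ρ / (2 * (s + 1)) * (2 - 4 / (s * K)) =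
        ∑ i ∈ Finset.range (k + m + 1),
          ((2 - 4 / (s * K)) / (2 * (s + 1)) * ((i : ℝ) + 1)) * β i := by
      simp only [mul_assoc, ← Finset.mul_sum, ← hρdef]
      ring
    rw [hrhs]
    refine Finset.sum_le_sum fun i hi => ?_
    have hi' : i ≤ k + m := Nat.lt_succ_iff.mp (Finset.mem_range.mp hi)
    refine mul_le_mul_of_nonneg_right ?_ (hβ i hi')
    have hgap : (2 - 4 / (s * K)) / (2 * (s + 1)) * ((i : ℝ) + 1) - a i =
        2 * (s - 1 - i) / (s * K) := by
      rw [ha i hi']; field_simp; ring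
    have hgap0 : 0 ≤ 2 * (s - 1 - i) / (s * K) :=
      div_nonneg (by linarith [his i hi']) (by positivity)
    linarith
  refine ⟨?_, fun i hi => ⟨?_, ?_⟩, hsum, hsum.trans_lt ?_⟩
  · have hD : (1 : ℝ) / 2 - s / n - 1 / ((n : ℝ) + 1) = -(K / (2 * n * ((n : ℝ) + 1))) := by
      rw [hK]; field_simp; ring
    rw [hD]
    exact neg_neg_of_pos (by positivity)
  · have h : a i - i / s = (K - 2 * s) * (s - i) / (s * ((s + 1) * K)) := by
      rw [ha i hi]; field_simp; ring
    have h0 : 0 ≤ (K - 2 * s) * (s - i) / (s * ((s + 1) * K)) :=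
      div_nonneg (mul_nonneg (by linarith) (by linarith [his i hi])) (by positivity)
    linarith
  · have h : 1 - a i = (s - i) * (K + 2) / ((s + 1) * K) := by
      rw [ha i hi]; field_simp; ring
    have h0 : 0 ≤ (s - i) * (K + 2) / ((s + 1) * K) :=
      div_nonneg (mul_nonneg (by linarith [his i hi]) (by linarith)) (by positivity)
    linarith
  · have hr0 : 0 < ρ / (2 * (s + 1)) := by positivity
    have hr1 : ρ / (2 * (s + 1)) ≤ 1 := (div_le_one (by positivity)).mpr hρle
    have hq : 0 < 4 / (s * K) := by positivity
    nlinarith [mul_pos hr0 hq]
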